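/- arXiv:2103.12931 — 2 statements merged into one kernel-verified Lean document; each statement's English description precedes it below -/
import Mathlib

section
/- Let (x*,λ*) be a saddle point of L, assume the scaling condition holds, and let (x,λ) be a global solution of the primal-dual dynamical system. Then ∫_{t₀}^{∞} (β(t)/δ − β̇(t)) · (L^σ(x(t),λ*) − L^σ(x*,λ(t))) dt < +∞. -/
open scoped RealInnerProductSpace
open MeasureTheory Set

noncomputable def Lagr {n m : ℕ} (f : EuclideanSpace ℝ (Fin n) → ℝ)
    (A : EuclideanSpace ℝ (Fin n) →L[ℝ] EuclideanSpace ℝ (Fin m))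
    (b : EuclideanSpace ℝ (Fin m))
    (x : EuclideanSpace ℝ (Fin n)) (lam : EuclideanSpace ℝ (Fin m)) : ℝ :=
  f x + ⟪lam, A x - b⟫

noncomputable def AugLagr {n m : ℕ} (f : EuclideanSpace ℝ (Fin n) → ℝ)
    (A : EuclideanSpace ℝ (Fin n) →L[ℝ] EuclideanSpace ℝ (Fin m))
    (b : EuclideanSpace ℝ (Fin m)) (σ : ℝ)
    (x : EuclideanSpace ℝ (Fin n)) (lam : EuclideanSpace ℝ (Fin m)) : ℝ :=
  Lagr f A b x lam + σ / 2 * ‖A x - b‖ ^ 2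

def IsSaddlePoint {n m : ℕ} (f : EuclideanSpace ℝ (Fin n) → ℝ)
    (A : EuclideanSpace ℝ (Fin n) →L[ℝ] EuclideanSpace ℝ (Fin m))
    (b : EuclideanSpace ℝ (Fin m))
    (xs : EuclideanSpace ℝ (Fin n)) (ls : EuclideanSpace ℝ (Fin m)) : Prop :=
  ∀ x lam, Lagr f A b xs lam ≤ Lagr f A b xs ls ∧ Lagr f A b xs ls ≤ Lagr f A b x ls

open InnerProductSpace in
theorem ConvexOn.add_inner_gradient_le {E : Type*} [NormedAddCommGroup E] [InnerProductSpace ℝ E]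
    [CompleteSpace E] {f : E → ℝ} (hf : ConvexOn ℝ Set.univ f) {x : E}
    (hd : DifferentiableAt ℝ f x) (y : E) :
    f x + ⟪gradient f x, y - x⟫ ≤ f y := by
  have hline : HasDerivAt (fun s : ℝ => f (AffineMap.lineMap x y s)) ⟪gradient f x, y - x⟫ 0 := by
    have h1 : HasDerivAt (fun s : ℝ => AffineMap.lineMap x y s) (y - x) 0 :=
      AffineMap.hasDerivAt_lineMap
    have h2 : HasFDerivAt f (toDual ℝ E (gradient f x)) (AffineMap.lineMap x y (0 : ℝ)) := by
      simpa using hd.hasGradientAt.hasFDerivAt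
    exact (h2.comp_hasDerivAt (0 : ℝ) h1).congr_deriv (by simp)
  have hconv : ConvexOn ℝ Set.univ (fun s : ℝ => f (AffineMap.lineMap x y s)) :=
    hf.comp_affineMap (AffineMap.lineMap x y)
  have := hconv.le_slope_of_hasDerivAt (Set.mem_univ 0) (Set.mem_univ 1) one_pos hline
  simp only [slope_def_field, AffineMap.lineMap_apply_one, AffineMap.lineMap_apply_zero,
    sub_zero, div_one] at this
  linarith

theorem IsSaddlePoint.map_eq {n m : ℕ} {f : EuclideanSpace ℝ (Fin n) → ℝ}
    {A : EuclideanSpace ℝ (Fin n) →L[ℝ] EuclideanSpace ℝ (Fin m)} {b : EuclideanSpace ℝ (Fin m)}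
    {xs : EuclideanSpace ℝ (Fin n)} {ls : EuclideanSpace ℝ (Fin m)}
    (h : IsSaddlePoint f A b xs ls) : A xs = b := by
  have h1 := (h xs (ls + (A xs - b))).1
  simp only [Lagr, inner_add_left] at h1
  have h2 : ⟪A xs - b, A xs - b⟫ = (0 : ℝ) :=
    le_antisymm (by linarith) real_inner_self_nonneg
  exact sub_eq_zero.mp (inner_self_eq_zero.mp h2)

/-- A continuous nonnegative function dominated by `-E'` for some nonnegative `E` is integrable. -/
theorem integrableOn_Ici_of_le_neg_deriv_of_nonneg {a : ℝ} {E E' h : ℝ → ℝ}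
    (hE : ∀ t ∈ Ici a, HasDerivWithinAt E (E' t) (Ici a) t) (hE0 : ∀ t ∈ Ici a, 0 ≤ E t)
    (hh : ContinuousOn h (Ici a)) (hh0 : ∀ t ∈ Ici a, 0 ≤ h t)
    (hle : ∀ t ∈ Ici a, h t ≤ -E' t) : IntegrableOn h (Ici a) := by
  rw [integrableOn_Ici_iff_integrableOn_Ioi]
  have hint : ∀ T : ℝ, IntegrableOn h (Icc a T) := fun T =>
    (hh.mono Icc_subset_Ici_self).integrableOn_Icc
  refine integrableOn_Ioi_of_intervalIntegral_norm_bounded (E a) a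
    (fun T : ℝ => (hint T).mono_set Ioc_subset_Icc_self) Filter.tendsto_id ?_
  filter_upwards [Filter.eventually_ge_atTop a] with T hT
  have hnorm : ∫ t in a..T, ‖h t‖ = ∫ t in a..T, h t := by
    refine intervalIntegral.integral_congr fun t ht => ?_
    rw [uIcc_of_le hT] at ht
    exact Real.norm_of_nonneg (hh0 t ht.1)
  rw [hnorm]
  have key := intervalIntegral.integral_le_sub_of_hasDeriv_right_of_le (g := fun t => -E t) hT
    (fun t ht => ((hE t ht.1).neg.continuousWithinAt.mono Icc_subset_Ici_self))
    (fun t ht => ((hE t ht.1.le).neg.mono fun s hs => ht.1.le.trans (le_of_lt hs)))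
    (hint T) (fun t ht => hle t ht.1.le)
  have := hE0 T hT
  linarith

theorem integral_lagrangian_gap_finite
    {n m : ℕ}
    (f : EuclideanSpace ℝ (Fin n) → ℝ)
    (hf_conv : ConvexOn ℝ Set.univ f)
    (hf_smooth : ContDiff ℝ 1 f)
    (A : EuclideanSpace ℝ (Fin n) →L[ℝ] EuclideanSpace ℝ (Fin m))
    (b : EuclideanSpace ℝ (Fin m))
    (t₀ γ δ σ : ℝ) (ht₀ : 0 ≤ t₀) (hγ : 0 < γ) (hδ : 0 < δ) (hσ : 0 < σ)
    (β β' : ℝ → ℝ)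
    (hβpos : ∀ t ∈ Ici t₀, 0 < β t)
    (hβderiv : ∀ t ∈ Ici t₀, HasDerivWithinAt β (β' t) (Ici t₀) t)
    (hβ'cont : ContinuousOn β' (Ici t₀))
    (xs : EuclideanSpace ℝ (Fin n)) (ls : EuclideanSpace ℝ (Fin m))
    (hsaddle : IsSaddlePoint f A b xs ls)
    (hscale : ∀ t ∈ Ici t₀, β' t ≤ β t / δ) (hscale' : 1 / δ < γ)
    (x x' x'' : ℝ → EuclideanSpace ℝ (Fin n))
    (lam lam' : ℝ → EuclideanSpace ℝ (Fin m))
    (hx : ∀ t ∈ Ici t₀, HasDerivWithinAt x (x' t) (Ici t₀) t)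
    (hx' : ∀ t ∈ Ici t₀, HasDerivWithinAt x' (x'' t) (Ici t₀) t)
    (hx''cont : ContinuousOn x'' (Ici t₀))
    (hlam : ∀ t ∈ Ici t₀, HasDerivWithinAt lam (lam' t) (Ici t₀) t)
    (hlam'cont : ContinuousOn lam' (Ici t₀))
    (hode1 : ∀ t ∈ Ici t₀, x'' t + γ • x' t =
      -(β t) • (gradient f (x t) + A.adjoint (lam t) + σ • A.adjoint (A (x t) - b)))
    (hode2 : ∀ t ∈ Ici t₀, lam' t = β t • (A (x t + δ • x' t) - b))
    :
    IntegrableOn (fun t => (β t / δ - β' t) *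
      (AugLagr f A b σ (x t) ls - AugLagr f A b σ xs (lam t))) (Ici t₀) := by
  have hAxs : A xs = b := hsaddle.map_eq
  have hfd : Differentiable ℝ f := hf_smooth.differentiable one_ne_zero
  set F : ℝ → ℝ := fun t => AugLagr f A b σ (x t) ls - AugLagr f A b σ xs (lam t) with hF
  have hF_eq : ∀ t, F t =
      f (x t) - f xs + ⟪ls, A (x t - xs)⟫ + σ / 2 * ‖A (x t - xs)‖ ^ 2 := by
    intro t
    simp [hF, AugLagr, Lagr, hAxs, map_sub]
    ring
  have hF_nonneg : ∀ t, 0 ≤ F t := by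
    intro t
    have h := (hsaddle (x t) ls).2
    simp only [Lagr, ← hAxs, ← map_sub, sub_self, inner_zero_right] at h
    have : 0 ≤ σ / 2 * ‖A (x t - xs)‖ ^ 2 := by positivity
    rw [hF_eq]
    linarith
  have hu : ∀ t ∈ Ici t₀, HasDerivWithinAt (fun t => x t - xs) (x' t) (Ici t₀) t :=
    fun t ht => (hx t ht).sub_const xs
  have hAu : ∀ t ∈ Ici t₀, HasDerivWithinAt (fun t => A (x t - xs)) (A (x' t)) (Ici t₀) t :=
    fun t ht => A.hasFDerivAt.comp_hasDerivWithinAt t (hu t ht)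
  have hF_deriv : ∀ t ∈ Ici t₀, HasDerivWithinAt F
      (⟪gradient f (x t), x' t⟫ + ⟪ls, A (x' t)⟫ + σ * ⟪A (x t - xs), A (x' t)⟫) (Ici t₀) t := by
    intro t ht
    have h1 : HasDerivWithinAt (fun t => f (x t)) ⟪gradient f (x t), x' t⟫ (Ici t₀) t := by
      simpa [Function.comp_def] using
        (hfd (x t)).hasGradientAt.hasFDerivAt.comp_hasDerivWithinAt t (hx t ht)
    have h2 := (hasDerivWithinAt_const t (Ici t₀) ls).inner ℝ (hAu t ht)
    have h3 := (hAu t ht).norm_sq.const_mul (σ / 2)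
    rw [funext hF_eq]
    refine (((h1.sub_const (f xs)).add h2).add h3).congr_deriv ?_
    simp
    ring
  have hv : ∀ t ∈ Ici t₀, HasDerivWithinAt (fun t => x t - xs + δ • x' t)
      (x' t + δ • x'' t) (Ici t₀) t :=
    fun t ht => (hu t ht).add ((hx' t ht).const_smul δ)
  have hE := fun t ht => (((((hβderiv t ht).mul (hF_deriv t ht)).add
    ((hv t ht).norm_sq.const_mul (1 / (2 * δ ^ 2)))).add
    ((hu t ht).norm_sq.const_mul ((δ * γ - 1) / (2 * δ ^ 2)))).add
    (((hlam t ht).sub_const ls).norm_sq.const_mul (1 / (2 * δ))))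
  have hδγ : 0 < δ * γ - 1 := by
    rw [div_lt_iff₀ hδ] at hscale'
    linarith
  refine integrableOn_Ici_of_le_neg_deriv_of_nonneg hE ?_ ?_ ?_ ?_
  · intro t ht
    have h1 := mul_nonneg (hβpos t ht).le (hF_nonneg t)
    simp only [Pi.add_apply, Pi.mul_apply]
    positivity
  · have hβc : ContinuousOn β (Ici t₀) := fun t ht => (hβderiv t ht).continuousWithinAt
    have hFc : ContinuousOn F (Ici t₀) := fun t ht => (hF_deriv t ht).continuousWithinAt
    exact ((hβc.div_const δ).sub hβ'cont).mul hFc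
  · exact fun t ht => mul_nonneg (sub_nonneg.mpr (hscale t ht)) (hF_nonneg t)
  · intro t ht
    have hgrad := hf_conv.add_inner_gradient_le (hfd (x t)) xs
    rw [← neg_sub (x t) xs, inner_neg_right] at hgrad
    have hx'' : x'' t = -(β t) • (gradient f (x t) + A.adjoint (lam t)
        + σ • A.adjoint (A (x t - xs))) - γ • x' t := by
      rw [map_sub A, hAxs, ← hode1 t ht]
      abel
    have hlam' : lam' t = β t • (A (x t - xs) + δ • A (x' t)) := by
      rw [hode2 t ht, ← hAxs, map_add, map_sub, map_smul]
      congr 1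
      abel
    have hF_le : F t ≤ ⟪gradient f (x t), x t - xs⟫ + ⟪ls, A (x t - xs)⟫
        + σ * ‖A (x t - xs)‖ ^ 2 := by
      have : 0 ≤ σ / 2 * ‖A (x t - xs)‖ ^ 2 := by positivity
      rw [hF_eq]
      linarith
    rw [hx'', hlam']
    change (β t / δ - β' t) * F t ≤ _
    generalize F t = Ft at hF_le ⊢
    generalize x t - xs = u at hF_le ⊢
    rw [← real_inner_self_eq_norm_sq] at hF_le
    simp only [inner_add_left, inner_add_right, inner_sub_left, inner_sub_right, inner_smul_left,
      inner_smul_right, ContinuousLinearMap.adjoint_inner_right, neg_smul,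
      map_add, map_smul, inner_neg_right, smul_add, smul_sub, conj_trivial] at hF_le ⊢
    simp only [real_inner_comm u (gradient f (x t)), real_inner_comm (x' t) (gradient f (x t)),
      real_inner_comm (A u) (lam t), real_inner_comm (A u) ls,
      real_inner_comm (A (x' t)) (lam t), real_inner_comm (A (x' t)) ls,
      real_inner_comm (A (x' t)) (A u)] at hF_le ⊢
    have hx'x' : 0 ≤ (δ * γ - 1) / δ * ⟪x' t, x' t⟫ :=
      mul_nonneg (by positivity) real_inner_self_nonneg
    have hmul := mul_le_mul_of_nonneg_left hF_le (div_nonneg (hβpos t ht).le hδ.le)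
    rw [← sub_nonneg] at hmul hx'x' ⊢
    refine (add_nonneg hmul hx'x').trans_eq ?_
    field_simp
    ring
end

section
/- Let (x*,λ*) be a saddle point of L, assume the scaling condition holds, and let (x,λ) be a global solution of the primal-dual dynamical system. Define the energy function E(t) = β(t)(L^σ(x(t),λ*) − L^σ(x*,λ*)) + ½‖(1/δ)(x(t) − x*) + ẋ(t)‖² + ((δγ − 1)/(2δ²))‖x(t) − x*‖² + (1/(2δ))‖λ(t) − λ*‖². Then E is nonnegative and nonincreasing on [t₀,∞); more precisely, its derivative satisfies Ė(t) ≤ (β̇(t) − β(t)/δ)(L^σ(x(t),λ*) − L^σ(x*,λ*)) − (σβ(t)/(2δ))‖Ax(t) − b‖² + ((1 − δγ)/δ)‖ẋ(t)‖² ≤ 0 for all t ≥ t₀. -/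
open scoped RealInnerProductSpace
open MeasureTheory Set

theorem ConvexOn.sub_le_inner_gradient {F : Type*} [NormedAddCommGroup F] [InnerProductSpace ℝ F]
    [CompleteSpace F] {f : F → ℝ} (hf : ConvexOn ℝ Set.univ f) {x : F}
    (hx : DifferentiableAt ℝ f x) (y : F) : f x - f y ≤ ⟪gradient f x, x - y⟫ := by
  have hline : HasDerivAt (AffineMap.lineMap x y : ℝ → F) (y - x) 0 := AffineMap.hasDerivAt_lineMap
  have hder : HasDerivAt (f ∘ (AffineMap.lineMap x y : ℝ → F)) ⟪gradient f x, y - x⟫ 0 := by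
    have hgrad : HasFDerivAt f (InnerProductSpace.toDual ℝ F (gradient f x))
        (AffineMap.lineMap x y (0 : ℝ)) := by
      simpa using hx.hasGradientAt.hasFDerivAt
    simpa using hgrad.comp_hasDerivAt 0 hline
  have hconv : ConvexOn ℝ Set.univ (f ∘ (AffineMap.lineMap x y : ℝ → F)) := by
    simpa using hf.comp_affineMap (AffineMap.lineMap x y : ℝ →ᵃ[ℝ] F)
  have hslope := hconv.le_slope_of_hasDerivAt (mem_univ 0) (mem_univ 1) one_pos hder
  rw [← neg_sub y x, inner_neg_right]
  simp only [slope, sub_zero, inv_one, one_smul, vsub_eq_sub, Function.comp_apply,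
    AffineMap.lineMap_apply_one, AffineMap.lineMap_apply_zero] at hslope
  linarith

theorem IsSaddlePoint.augLagr_sub_nonneg {n m : ℕ} {f : EuclideanSpace ℝ (Fin n) → ℝ}
    {A : EuclideanSpace ℝ (Fin n) →L[ℝ] EuclideanSpace ℝ (Fin m)} {b : EuclideanSpace ℝ (Fin m)}
    {xs : EuclideanSpace ℝ (Fin n)} {ls : EuclideanSpace ℝ (Fin m)}
    (h : IsSaddlePoint f A b xs ls) {σ : ℝ} (hσ : 0 ≤ σ) (x : EuclideanSpace ℝ (Fin n)) :
    0 ≤ AugLagr f A b σ x ls - AugLagr f A b σ xs ls := by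
  have h1 := (h x ls).2
  have h2 : 0 ≤ σ / 2 * ‖A x - b‖ ^ 2 := by positivity
  simp only [AugLagr, h.map_eq, sub_self, norm_zero]
  linarith

theorem HasDerivWithinAt.augLagr {n m : ℕ} {f : EuclideanSpace ℝ (Fin n) → ℝ}
    {A : EuclideanSpace ℝ (Fin n) →L[ℝ] EuclideanSpace ℝ (Fin m)} {b : EuclideanSpace ℝ (Fin m)}
    {σ : ℝ} {ls : EuclideanSpace ℝ (Fin m)} {x : ℝ → EuclideanSpace ℝ (Fin n)}
    {v : EuclideanSpace ℝ (Fin n)} {s : Set ℝ} {t : ℝ} (hf : DifferentiableAt ℝ f (x t))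
    (hx : HasDerivWithinAt x v s t) :
    HasDerivWithinAt (fun τ => AugLagr f A b σ (x τ) ls)
      (⟪gradient f (x t), v⟫ + ⟪ls, A v⟫ + σ * ⟪A (x t) - b, A v⟫) s t := by
  have hfx : HasDerivWithinAt (fun τ => f (x τ)) ⟪gradient f (x t), v⟫ s t :=
    hf.hasGradientAt.hasFDerivAt.comp_hasDerivWithinAt t hx
  have hA : HasDerivWithinAt (fun τ => A (x τ) - b) (A v) s t :=
    (A.hasFDerivAt.comp_hasDerivWithinAt t hx).sub_const b
  have hlin : HasDerivWithinAt (fun τ => ⟪ls, A (x τ) - b⟫) ⟪ls, A v⟫ s t := by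
    simpa using (hasDerivWithinAt_const t s ls).inner ℝ hA
  exact ((hfx.add hlin).add (hA.norm_sq.const_mul (σ / 2))).congr_deriv (by ring)

theorem energy_nonincreasing
    {n m : ℕ}
    (f : EuclideanSpace ℝ (Fin n) → ℝ)
    (hf_conv : ConvexOn ℝ Set.univ f)
    (hf_smooth : ContDiff ℝ 1 f)
    (A : EuclideanSpace ℝ (Fin n) →L[ℝ] EuclideanSpace ℝ (Fin m))
    (b : EuclideanSpace ℝ (Fin m))
    (t₀ γ δ σ : ℝ) (ht₀ : 0 ≤ t₀) (hγ : 0 < γ) (hδ : 0 < δ) (hσ : 0 < σ)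
    (β β' : ℝ → ℝ)
    (hβpos : ∀ t ∈ Ici t₀, 0 < β t)
    (hβderiv : ∀ t ∈ Ici t₀, HasDerivWithinAt β (β' t) (Ici t₀) t)
    (hβ'cont : ContinuousOn β' (Ici t₀))
    (xs : EuclideanSpace ℝ (Fin n)) (ls : EuclideanSpace ℝ (Fin m))
    (hsaddle : IsSaddlePoint f A b xs ls)
    (hscale : ∀ t ∈ Ici t₀, β' t ≤ β t / δ) (hscale' : 1 / δ < γ)
    (x x' x'' : ℝ → EuclideanSpace ℝ (Fin n))
    (lam lam' : ℝ → EuclideanSpace ℝ (Fin m))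
    (hx : ∀ t ∈ Ici t₀, HasDerivWithinAt x (x' t) (Ici t₀) t)
    (hx' : ∀ t ∈ Ici t₀, HasDerivWithinAt x' (x'' t) (Ici t₀) t)
    (hx''cont : ContinuousOn x'' (Ici t₀))
    (hlam : ∀ t ∈ Ici t₀, HasDerivWithinAt lam (lam' t) (Ici t₀) t)
    (hlam'cont : ContinuousOn lam' (Ici t₀))
    (hode1 : ∀ t ∈ Ici t₀, x'' t + γ • x' t =
      -(β t) • (gradient f (x t) + A.adjoint (lam t) + σ • A.adjoint (A (x t) - b)))
    (hode2 : ∀ t ∈ Ici t₀, lam' t = β t • (A (x t + δ • x' t) - b))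
    (E : ℝ → ℝ)
    (hE : ∀ t, E t = β t * (AugLagr f A b σ (x t) ls - AugLagr f A b σ xs ls)
      + (1 / 2) * ‖(1 / δ) • (x t - xs) + x' t‖ ^ 2
      + ((δ * γ - 1) / (2 * δ ^ 2)) * ‖x t - xs‖ ^ 2
      + (1 / (2 * δ)) * ‖lam t - ls‖ ^ 2)
    :
    (∀ t ∈ Ici t₀, 0 ≤ E t) ∧ AntitoneOn E (Ici t₀) ∧
    ∃ E' : ℝ → ℝ, (∀ t ∈ Ici t₀, HasDerivWithinAt E (E' t) (Ici t₀) t) ∧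
      ∀ t ∈ Ici t₀,
        E' t ≤ (β' t - β t / δ) * (AugLagr f A b σ (x t) ls - AugLagr f A b σ xs ls)
          - (σ * β t / (2 * δ)) * ‖A (x t) - b‖ ^ 2
          + ((1 - δ * γ) / δ) * ‖x' t‖ ^ 2 ∧
        (β' t - β t / δ) * (AugLagr f A b σ (x t) ls - AugLagr f A b σ xs ls)
          - (σ * β t / (2 * δ)) * ‖A (x t) - b‖ ^ 2
          + ((1 - δ * γ) / δ) * ‖x' t‖ ^ 2 ≤ 0 := by
  have hdiff : Differentiable ℝ f := hf_smooth.differentiable one_ne_zero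
  have hAxs := hsaddle.map_eq
  have hgap := hsaddle.augLagr_sub_nonneg hσ.le
  have hδγ : 1 < δ * γ := by rwa [div_lt_iff₀' hδ] at hscale'
  set E' : ℝ → ℝ := fun t =>
    β' t * (AugLagr f A b σ (x t) ls - AugLagr f A b σ xs ls)
      + β t * (⟪gradient f (x t), x' t⟫ + ⟪ls, A (x' t)⟫ + σ * ⟪A (x t) - b, A (x' t)⟫)
      + (1 / 2) * (2 * ⟪(1 / δ) • (x t - xs) + x' t, (1 / δ) • x' t + x'' t⟫)
      + ((δ * γ - 1) / (2 * δ ^ 2)) * (2 * ⟪x t - xs, x' t⟫)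
      + (1 / (2 * δ)) * (2 * ⟪lam t - ls, lam' t⟫) with hE'
  have hderiv : ∀ t ∈ Ici t₀, HasDerivWithinAt E (E' t) (Ici t₀) t := by
    intro t ht
    have hxs := (hx t ht).sub_const xs
    rw [show E = _ from funext hE]
    exact ((((hβderiv t ht).mul
      (((hx t ht).augLagr (hdiff (x t))).sub_const (AugLagr f A b σ xs ls))).add
      (((hxs.const_smul (1 / δ)).add (hx' t ht)).norm_sq.const_mul (1 / 2))).add
      (hxs.norm_sq.const_mul ((δ * γ - 1) / (2 * δ ^ 2)))).add
      (((hlam t ht).sub_const ls).norm_sq.const_mul (1 / (2 * δ)))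
  have hbound : ∀ t ∈ Ici t₀,
      E' t ≤ (β' t - β t / δ) * (AugLagr f A b σ (x t) ls - AugLagr f A b σ xs ls)
        - (σ * β t / (2 * δ)) * ‖A (x t) - b‖ ^ 2 + ((1 - δ * γ) / δ) * ‖x' t‖ ^ 2 := by
    intro t ht
    have hconv := mul_le_mul_of_nonneg_left (hf_conv.sub_le_inner_gradient (hdiff (x t)) xs)
      (div_pos (hβpos t ht) hδ).le
    have hx'' : x'' t = -(γ • x' t) -
        β t • (gradient f (x t) + A.adjoint (lam t) + σ • A.adjoint (A (x t) - b)) := by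
      rw [eq_sub_of_add_eq (hode1 t ht), neg_smul]
      abel
    have hAx : A (x t - xs) = A (x t) - b := by rw [map_sub, hAxs]
    have hlam'' : lam' t = β t • ((A (x t) - b) + δ • A (x' t)) := by
      rw [hode2 t ht, map_add, map_smul, add_sub_right_comm]
    simp only [hE', AugLagr, Lagr, hAxs, sub_self, norm_zero, inner_zero_right, hx'', hlam'']
    rw [← hAx]
    generalize x t - xs = y at hconv ⊢
    simp only [inner_add_left, inner_add_right, inner_sub_left, inner_sub_right, inner_neg_right,
      real_inner_smul_left, real_inner_smul_right, ContinuousLinearMap.adjoint_inner_right,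
      real_inner_self_eq_norm_sq, real_inner_comm (A y) (A (x' t)), map_smul, real_inner_comm (gradient f (x t)),
      real_inner_comm (lam t)]
    field_simp at hconv ⊢
    linear_combination (2 * δ) * hconv
  have hnonpos : ∀ t ∈ Ici t₀,
      (β' t - β t / δ) * (AugLagr f A b σ (x t) ls - AugLagr f A b σ xs ls)
        - (σ * β t / (2 * δ)) * ‖A (x t) - b‖ ^ 2 + ((1 - δ * γ) / δ) * ‖x' t‖ ^ 2 ≤ 0 := by
    intro t ht
    have hβt := hβpos t ht
    have h1 := mul_nonpos_of_nonpos_of_nonneg (sub_nonpos.mpr (hscale t ht)) (hgap (x t))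
    have h2 : 0 ≤ (σ * β t / (2 * δ)) * ‖A (x t) - b‖ ^ 2 := by positivity
    have h3 := mul_nonpos_of_nonpos_of_nonneg
      (div_nonpos_of_nonpos_of_nonneg (sub_nonpos.mpr hδγ.le) hδ.le) (sq_nonneg ‖x' t‖)
    linarith
  refine ⟨fun t ht => ?_, ?_, E', hderiv, fun t ht => ⟨hbound t ht, hnonpos t ht⟩⟩
  · have h1 := mul_nonneg (hβpos t ht).le (hgap (x t))
    have h2 : 0 ≤ (δ * γ - 1) / (2 * δ ^ 2) := div_nonneg (by linarith) (by positivity)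
    rw [hE]
    positivity
  · refine antitoneOn_of_hasDerivWithinAt_nonpos (convex_Ici t₀)
      (fun t ht => (hderiv t ht).continuousWithinAt)
      (fun t ht => (hderiv t (interior_subset ht)).mono interior_subset)
      fun t ht => (hbound t (interior_subset ht)).trans (hnonpos t (interior_subset ht))
end
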